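/- Let G be a connected graph on n vertices with minimum degree δ(G) ≥ r ≥ 1, where n ≥ k ≥ 4, and set h = ⌊(k-2)/2⌋. If the number of copies of K_{s,s} in G exceeds max{ g_{s,s}(n,k-1,r), g_{s,s}(n,k-1,h) }, where g_{s,s}(n,m,a) = Σ_{i=1}^{n-m+a} C(a,s)·C(n-s-i, s-1) + (1/2)·C(m-a, 2s)·C(2s, s), then G contains a path on k vertices. -/

import Mathlib

/-- The number of (unordered, not necessarily induced) copies of the complete bipartite
graph `K_{s,s}` in `G`: half the number of ordered pairs `(S, T)` of disjoint `s`-sets of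
vertices with all edges between `S` and `T` present. -/
noncomputable def kssCount {V : Type*} [Fintype V] (G : SimpleGraph V) (s : ℕ) : ℕ :=
  ({p : Finset V × Finset V | p.1.card = s ∧ p.2.card = s ∧ Disjoint p.1 p.2 ∧
      ∀ x ∈ p.1, ∀ y ∈ p.2, G.Adj x y} : Set (Finset V × Finset V)).ncard / 2

/-- `g_{s,s}(n, m, a) = Σ_{i=1}^{n-m+a} C(a,s)·C(n-s-i, s-1) + (1/2)·C(m-a, 2s)·C(2s, s)`. -/
def gss (n m a s : ℕ) : ℕ :=
  (∑ i ∈ Finset.Icc 1 (n - m + a), a.choose s * (n - s - i).choose (s - 1))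
    + (m - a).choose (2 * s) * (2 * s).choose s / 2


namespace KSS

/-- no path with at least `k` vertices -/
def NoPath {V : Type*} (G : SimpleGraph V) (k : ℕ) : Prop :=
  ∀ l : List V, l.Nodup → l.IsChain G.Adj → l.length < k

theorem chain_rev {V : Type*} {G : SimpleGraph V} {l : List V} (h : l.IsChain G.Adj) :
    l.reverse.IsChain G.Adj := by
  rw [List.isChain_reverse]
  exact h.imp (fun a b hab => hab.symm)

theorem gap_lemma (N : ℕ) (I J : Finset ℕ) (hI : I ⊆ Finset.range N) (hJ : J ⊆ Finset.range N)
    (h0 : 0 ∉ I) (hN : N - 1 ∉ J) (hc : ∃ i ∈ I, ∃ j ∈ J, j < i) :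
    ∃ i ∈ I, ∃ j ∈ J, j < i ∧ (i = j + 1 ∨ I.card + J.card + (i - j) ≤ N + 1) := by
  classical
  have hc' : ∃ d, ∃ i ∈ I, ∃ j ∈ J, j < i ∧ i - j = d := by
    obtain ⟨i, hi, j, hj, hij⟩ := hc
    exact ⟨_, i, hi, j, hj, hij, rfl⟩
  obtain ⟨i, hi, j, hj, hij, hd⟩ := Nat.find_spec hc'
  have hmin : ∀ i' ∈ I, ∀ j' ∈ J, j' < i' → i - j ≤ i' - j' := by
    intro i' hi' j' hj' h
    rw [hd]
    exact Nat.find_min' hc' ⟨i', hi', j', hj', h, rfl⟩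
  refine ⟨i, hi, j, hj, hij, ?_⟩
  by_cases h1 : i = j + 1
  · exact Or.inl h1
  right
  have hdisj : Disjoint I (J.image (· + 1)) := by
    rw [Finset.disjoint_left]
    intro x hx hx'
    obtain ⟨y, hy, rfl⟩ := Finset.mem_image.1 hx'
    have := hmin _ hx y hy (by simp)
    omega
  have hsub : I ∪ J.image (· + 1) ⊆ (Finset.Ico 1 N) \ (Finset.Ico (j+2) i) := by
    intro x hx
    rw [Finset.mem_sdiff, Finset.mem_Ico, Finset.mem_Ico]
    rcases Finset.mem_union.1 hx with hx | hx
    · have h2 := Finset.mem_range.1 (hI hx)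
      have h3 : x ≠ 0 := fun h => h0 (h ▸ hx)
      refine ⟨by omega, fun h => ?_⟩
      have := hmin x hx j hj (by omega)
      omega
    · obtain ⟨y, hy, rfl⟩ := Finset.mem_image.1 hx
      have h2 := Finset.mem_range.1 (hJ hy)
      have h3 : y ≠ N - 1 := fun h => hN (h ▸ hy)
      refine ⟨by omega, fun h => ?_⟩
      have := hmin i hi y hy (by omega)
      omega
  have hcard := Finset.card_le_card hsub
  rw [Finset.card_union_of_disjoint hdisj,
    Finset.card_image_of_injective _ (add_left_injective 1), Finset.card_sdiff_of_subset,
    Nat.card_Ico, Nat.card_Ico] at hcard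
  · have := Finset.mem_range.1 (hI hi)
    omega
  · intro x hx
    have := Finset.mem_range.1 (hI hi)
    rw [Finset.mem_Ico] at *
    omega

theorem cycle_lemma {W : Type*} {G : SimpleGraph W} (w : List W) (hnd : w.Nodup)
    (hch : w.IsChain G.Adj) (I J : Finset ℕ)
    (hI : ∀ i ∈ I, ∃ h : i < w.length, G.Adj (w[0]'(by omega)) w[i])
    (hJ : ∀ i ∈ J, ∃ h : i < w.length, G.Adj (w[w.length - 1]'(by omega)) w[i])
    (hc : ∃ i ∈ I, ∃ j ∈ J, j < i) :
    ∃ c : List W, c.Nodup ∧ c.IsChain G.Adj ∧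
      (∀ x ∈ c.getLast?, ∀ y ∈ c.head?, G.Adj x y) ∧
      min w.length (I.card + J.card) ≤ c.length := by
  obtain ⟨i, hi, j, hj, hij, h⟩ := gap_lemma w.length I J
    (fun i hi => Finset.mem_range.2 (hI i hi).1) (fun i hi => Finset.mem_range.2 (hJ i hi).1)
    (fun h => by obtain ⟨_, h⟩ := hI 0 h; exact G.loopless.irrefl _ h)
    (fun h => by obtain ⟨_, h⟩ := hJ _ h; exact G.loopless.irrefl _ h) hc
  obtain ⟨hiw, hi'⟩ := hI i hi
  obtain ⟨hjw, hj'⟩ := hJ j hj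
  refine ⟨w.take (j+1) ++ (w.drop i).reverse, ?_, ?_, ?_, ?_⟩
  · rw [List.nodup_append']
    refine ⟨hnd.sublist (List.take_sublist _ _),
      List.nodup_reverse.2 (hnd.sublist (List.drop_sublist _ _)), ?_⟩
    rw [List.disjoint_reverse_right]
    exact List.disjoint_take_drop hnd (by omega)
  · refine List.IsChain.append (hch.take _) (chain_rev (hch.drop _)) ?_
    intro x hx y hy
    rw [List.head?_reverse] at hy
    rw [List.getLast?_eq_getElem?] at hx hy
    simp at hx hy
    rw [min_eq_left (by omega)] at hx
    have e : i + (w.length - i - 1) = w.length - 1 := by omega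
    rw [e] at hy
    simp only [Nat.add_sub_cancel] at hx
    rw [List.getElem?_eq_getElem hjw] at hx
    rw [List.getElem?_eq_getElem (by omega)] at hy
    simp at hx hy
    subst hx hy
    exact hj'.symm
  · intro x hx y hy
    have hne : w.drop i ≠ [] := by simp; omega
    have hne2 : w.take (j+1) ≠ [] := by
      intro h; have := congrArg List.length h; rw [List.length_take, List.length_nil] at this; omega
    rw [List.getLast?_append_of_ne_nil _ (by simpa using hne), List.getLast?_reverse] at hx
    rw [List.head?_append_of_ne_nil _ hne2] at hy
    simp at hx
    rw [List.head?_eq_getElem?, List.getElem?_take_of_lt (by omega),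
      List.getElem?_eq_getElem (by omega)] at hy
    simp [List.getElem?_eq_getElem hiw] at hx hy
    subst hx hy
    exact hi'.symm
  · simp
    omega

theorem cycle_lemma' {W : Type*} [BEq W] [LawfulBEq W] {G : SimpleGraph W} (w : List W) (hnd : w.Nodup)
    (hch : w.IsChain G.Adj) (hne : w ≠ []) (S T : Finset W)
    (hS : ∀ x ∈ S, x ∈ w ∧ G.Adj (w.head hne) x)
    (hT : ∀ x ∈ T, x ∈ w ∧ G.Adj (w.getLast hne) x)
    (hc : ∃ x ∈ S, ∃ y ∈ T, w.idxOf y < w.idxOf x) :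
    ∃ c : List W, c.Nodup ∧ c.IsChain G.Adj ∧
      (∀ x ∈ c.getLast?, ∀ y ∈ c.head?, G.Adj x y) ∧
      min w.length (S.card + T.card) ≤ c.length := by
  have key := cycle_lemma w hnd hch (S.image (w.idxOf ·)) (T.image (w.idxOf ·)) ?_ ?_ ?_
  · rwa [Finset.card_image_of_injOn, Finset.card_image_of_injOn] at key
    · intro x hx y hy h
      exact (List.idxOf_inj (hT x hx).1).1 h
    · intro x hx y hy h
      exact (List.idxOf_inj (hS x hx).1).1 h
  · intro i hi
    obtain ⟨x, hx, rfl⟩ := Finset.mem_image.1 hi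
    refine ⟨List.idxOf_lt_length_of_mem (hS x hx).1, ?_⟩
    have := (hS x hx).2
    rw [List.head_eq_getElem] at this
    simpa using this
  · intro i hi
    obtain ⟨x, hx, rfl⟩ := Finset.mem_image.1 hi
    refine ⟨List.idxOf_lt_length_of_mem (hT x hx).1, ?_⟩
    have := (hT x hx).2
    rw [List.getLast_eq_getElem] at this
    simpa using this
  · obtain ⟨x, hx, y, hy, h⟩ := hc
    exact ⟨_, Finset.mem_image_of_mem _ hx, _, Finset.mem_image_of_mem _ hy, h⟩

/-- add a dominating vertex -/
def cone {V : Type*} (G : SimpleGraph V) : SimpleGraph (Option V) where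
  Adj x y := match x, y with
    | none, none => False
    | none, some _ => True
    | some _, none => True
    | some a, some b => G.Adj a b
  symm := ⟨by
    rintro (_ | a) (_ | b) h
    · exact h
    · trivial
    · trivial
    · exact SimpleGraph.Adj.symm h⟩
  loopless := ⟨by
    rintro (_ | a) h
    · exact h
    · exact G.loopless.irrefl a h⟩

theorem lift_some {V : Type*} (c : List (Option V)) (h : none ∉ c) : ∃ l : List V, c = l.map some := by
  induction c with
  | nil => exact ⟨[], rfl⟩
  | cons x c ih =>
    obtain ⟨l, rfl⟩ := ih (fun h' => h (List.mem_cons_of_mem _ h'))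
    cases x with
    | none => simp at h
    | some a => exact ⟨a :: l, rfl⟩

theorem cone_path {V : Type*} {G : SimpleGraph V} {k : ℕ} (hG : NoPath G k)
    (c : List (Option V)) (h : none ∉ c) (hnd : c.Nodup) (hch : c.IsChain (cone G).Adj) :
    c.length < k := by
  obtain ⟨l, rfl⟩ := lift_some c h
  rw [List.isChain_map] at hch
  simpa using hG l (List.Nodup.of_map _ hnd) hch

theorem cone_cycle {V : Type*} {G : SimpleGraph V} {k : ℕ} (hG : NoPath G k)
    (c : List (Option V)) (hnd : c.Nodup) (hch : c.IsChain (cone G).Adj)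
    (hcl : ∀ x ∈ c.getLast?, ∀ y ∈ c.head?, (cone G).Adj x y) : c.length ≤ k := by
  by_cases h : none ∈ c
  · obtain ⟨s, t, rfl⟩ := List.append_of_mem h
    have hnd' : (none :: (t ++ s)).Nodup := by
      have : (s ++ none :: t).Perm (none :: (t ++ s)) := by
        have := (List.perm_append_comm : (s ++ none :: t).Perm (none :: t ++ s))
        simpa using this
      exact this.nodup hnd
    rw [List.nodup_cons] at hnd'
    rw [List.isChain_append, List.isChain_cons] at hch
    have := cone_path hG (t ++ s) hnd'.1 hnd'.2 (by
      refine List.IsChain.append hch.2.1.2 hch.1 ?_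
      intro x hx y hy
      apply hcl
      · rw [List.getLast?_append_of_ne_nil _ (by simp)]
        cases t with
        | nil => simp at hx
        | cons a t => simpa using hx
      · cases s with
        | nil => simp at hy
        | cons a t => simpa using hy)
    simp at this ⊢
    omega
  · exact (cone_path hG c h hnd hch).le

theorem exists_last_split {V : Type*} (S : Finset V) (Y : List V) (h : ∃ y ∈ Y, y ∈ S) :
    ∃ Y1 y Y2, Y = Y1 ++ y :: Y2 ∧ y ∈ S ∧ ∀ z ∈ Y2, z ∉ S := by
  induction Y with
  | nil => simp at h
  | cons x Y ih =>
    by_cases h' : ∃ y ∈ Y, y ∈ S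
    · obtain ⟨Y1, y, Y2, rfl, h1, h2⟩ := ih h'
      exact ⟨x :: Y1, y, Y2, rfl, h1, h2⟩
    · push Not at h'
      obtain ⟨y, hy, hyS⟩ := h
      rcases List.mem_cons.1 hy with rfl | hy
      · exact ⟨[], y, Y, rfl, hyS, h'⟩
      · exact absurd hyS (h' y hy)

theorem reroute {V : Type*} [DecidableEq V] {G : SimpleGraph V} (u : V) (P : List V)
    (hnd : (u :: P).Nodup) (hch : (u :: P).IsChain G.Adj) (S : Finset V)
    (hS : ∀ x ∈ S, x ∈ u :: P ∧ G.Adj u x) (p : V) (hp : p ∈ u :: P) :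
    ∃ Q : List V, (p :: Q).Nodup ∧ (p :: Q).IsChain G.Adj ∧ (∀ x ∈ p :: Q, x ∈ u :: P) ∧
      S.card ≤ Q.length := by
  have huS : u ∉ S := fun h => G.loopless.irrefl _ (hS u h).2
  suffices H : ∃ Q : List V, (p :: Q).Nodup ∧ (p :: Q).IsChain G.Adj ∧
      (∀ x ∈ p :: Q, x ∈ u :: P) ∧ ∀ x ∈ insert u S, x ∈ p :: Q by
    obtain ⟨Q, h1, h2, h3, h4⟩ := H
    refine ⟨Q, h1, h2, h3, ?_⟩
    have : (insert u S).card ≤ (p :: Q).toFinset.card :=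
      Finset.card_le_card (fun x hx => List.mem_toFinset.2 (h4 x hx))
    rw [Finset.card_insert_of_notMem huS, List.toFinset_card_of_nodup h1] at this
    simpa using this
  obtain ⟨X, Y, hXY⟩ := List.append_of_mem hp
  have hu : u ∈ X ++ [p] := by
    cases X with
    | nil => simp at hXY ⊢; exact hXY.1
    | cons a X => simp at hXY ⊢; exact Or.inl hXY.1
  have hXu : ∀ y ∈ X.head?, y = u := by
    intro y hy
    cases X with
    | nil => simp at hy
    | cons a X => simp at hXY hy; rw [← hy, hXY.1]
  rw [hXY] at hnd hch hS ⊢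
  by_cases h : ∃ y ∈ Y, y ∈ S
  · obtain ⟨Y1, y, Y2, rfl, hy, hY2⟩ := exists_last_split S Y h
    refine ⟨Y1 ++ y :: X, ?_, ?_, ?_, ?_⟩
    · have hsub : (X ++ (p :: (Y1 ++ [y]))).Nodup := by
        refine hnd.sublist ?_
        simp
      have := (List.perm_append_comm : (X ++ (p :: (Y1 ++ [y]))).Perm _).nodup hsub
      simpa using this
    · have e : p :: (Y1 ++ y :: X) = (p :: Y1 ++ [y]) ++ X := by simp
      rw [e]
      have hch2 : (X ++ ((p :: Y1 ++ [y]) ++ Y2)).IsChain G.Adj := by simpa using hch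
      rw [List.isChain_append, List.isChain_append] at hch2
      refine List.IsChain.append hch2.2.1.1 hch2.1 ?_
      intro a ha b hb
      rw [hXu b hb]
      rw [List.getLast?_append_of_ne_nil _ (by simp)] at ha
      simp at ha
      subst ha
      exact (hS y hy).2.symm
    · intro x hx
      simp at hx ⊢
      tauto
    · intro x hx
      rcases Finset.mem_insert.1 hx with rfl | hx
      · simp at hu ⊢
        tauto
      · have h1 := (hS x hx).1
        have h2 : x ∉ Y2 := fun h => hY2 x h hx
        simp at h1 ⊢
        tauto
  · push Not at h
    refine ⟨X.reverse, ?_, ?_, ?_, ?_⟩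
    · have hsub : (X ++ [p]).Nodup := by
        refine hnd.sublist ?_
        simp
      have := List.nodup_reverse.2 hsub
      simpa using this
    · have hch2 : ((X ++ [p]) ++ Y).IsChain G.Adj := by simpa using hch
      rw [List.isChain_append] at hch2
      have := chain_rev hch2.1
      simpa using this
    · intro x hx
      simp at hx ⊢
      tauto
    · intro x hx
      rcases Finset.mem_insert.1 hx with rfl | hx
      · simp at hu ⊢
        tauto
      · have h1 := (hS x hx).1
        have h2 : x ∉ Y := fun h' => h x h' hx
        simp at h1 ⊢
        tauto

theorem connect_aux {V : Type*} {G : SimpleGraph V} (A B : List V) (m : ℕ) :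
    ∀ (a b : V) (R : List V), R.length = m → a ∈ A → b ∈ B → (a :: R ++ [b]).Nodup →
      (a :: R ++ [b]).IsChain G.Adj →
    ∃ (a b : V) (R : List V), a ∈ A ∧ b ∈ B ∧ (a :: R ++ [b]).Nodup ∧
      (a :: R ++ [b]).IsChain G.Adj ∧ (∀ x ∈ R, x ∉ A ∧ x ∉ B) := by
  induction m using Nat.strong_induction_on with
  | _ m ih =>
    intro a b R hR ha hb hnd hch
    by_cases h : ∃ x ∈ R, x ∈ A ∨ x ∈ B
    · obtain ⟨x, hx, hxAB⟩ := h
      obtain ⟨R1, R2, rfl⟩ := List.append_of_mem hx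
      simp at hR
      rcases hxAB with hxA | hxB
      · refine ih R2.length (by omega) x b R2 rfl hxA hb (hnd.sublist ?_) ?_
        · have : a :: (R1 ++ x :: R2) ++ [b] = (a :: R1) ++ (x :: R2 ++ [b]) := by simp
          rw [this]
          exact List.sublist_append_right _ _
        · have : a :: (R1 ++ x :: R2) ++ [b] = (a :: R1) ++ (x :: R2 ++ [b]) := by simp
          rw [this, List.isChain_append] at hch
          exact hch.2.1
      · refine ih R1.length (by omega) a x R1 rfl ha hxB (hnd.sublist ?_) ?_
        · have : a :: (R1 ++ x :: R2) ++ [b] = (a :: R1 ++ [x]) ++ (R2 ++ [b]) := by simp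
          rw [this]
          exact List.sublist_append_left _ _
        · have : a :: (R1 ++ x :: R2) ++ [b] = (a :: R1 ++ [x]) ++ (R2 ++ [b]) := by simp
          rw [this, List.isChain_append] at hch
          exact hch.1
    · push Not at h
      exact ⟨a, b, R, ha, hb, hnd, hch, h⟩

theorem connect {V : Type*} [DecidableEq V] {G : SimpleGraph V} (hG : G.Connected) (A B : List V)
    (u v : V) (hu : u ∈ A) (hv : v ∈ B) (huv : u ≠ v) :
    ∃ (a b : V) (R : List V), a ∈ A ∧ b ∈ B ∧ (a :: R ++ [b]).Nodup ∧
      (a :: R ++ [b]).IsChain G.Adj ∧ (∀ x ∈ R, x ∉ A ∧ x ∉ B) := by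
  obtain ⟨p, hp⟩ := (hG.preconnected u v).exists_isPath
  have h1 := hp.support_nodup
  have h2 := p.isChain_adj_support
  have h3 : ∃ R, p.support = u :: R ++ [v] := by
    cases p with
    | nil => exact absurd rfl huv
    | cons h q =>
      refine ⟨q.support.dropLast, ?_⟩
      rw [SimpleGraph.Walk.support_cons]
      have := List.dropLast_append_getLast q.support_ne_nil
      rw [SimpleGraph.Walk.getLast_support] at this
      rw [List.cons_append, this]
  obtain ⟨R, hR⟩ := h3
  rw [hR] at h1 h2
  exact connect_aux A B _ u v R rfl hu hv h1 h2

theorem lemX {V : Type*} [DecidableEq V] {G : SimpleGraph V} (hG : G.Connected) {k : ℕ}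
    (hk : NoPath G k) (u v : V) (A B : List V) (hnd : ((u :: A) ++ (v :: B)).Nodup)
    (hA : (u :: A).IsChain G.Adj) (hB : (v :: B).IsChain G.Adj) (S T : Finset V)
    (hS : ∀ x ∈ S, (x ∈ u :: A ∨ x ∈ v :: B) ∧ G.Adj u x)
    (hT : ∀ x ∈ T, (x ∈ u :: A ∨ x ∈ v :: B) ∧ G.Adj v x)
    (hlen : k ≤ (u :: A).length + (v :: B).length) (hST : k ≤ S.card + T.card + 1) : False := by
  have hnd' := List.nodup_append'.1 hnd
  by_cases hc : (∃ x ∈ S, x ∈ v :: B) ∨ (∃ x ∈ T, x ∈ u :: A)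
  · set w : List (Option V) := (u :: A).map some ++ none :: ((v :: B).map some).reverse with hw
    have hwne : w ≠ [] := by simp [hw]
    have hwnd : w.Nodup := by
      rw [hw, List.nodup_append', List.nodup_cons, List.nodup_reverse]
      refine ⟨hnd'.1.map (Option.some_injective _), ⟨by simp,
        hnd'.2.1.map (Option.some_injective _)⟩, ?_⟩
      intro x hx hx'
      obtain ⟨y, hy, rfl⟩ := List.mem_map.1 hx
      have : y ∈ v :: B := by simpa [-List.map_cons] using hx'
      exact hnd'.2.2 hy this
    have hwch : w.IsChain (cone G).Adj := by
      rw [hw]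
      refine List.IsChain.append ?_ ?_ ?_
      · rw [List.isChain_map]
        exact hA
      · rw [List.isChain_cons]
        constructor
        · intro y hy
          have : y ∈ ((v :: B).map some).reverse := List.mem_of_mem_head? hy
          rw [List.mem_reverse] at this
          obtain ⟨z, _, rfl⟩ := List.mem_map.1 this
          trivial
        · apply chain_rev
          rw [List.isChain_map]
          exact hB
      · intro x hx y hy
        have : x ∈ ((u :: A).map some) := List.mem_of_getLast? hx
        obtain ⟨z, _, rfl⟩ := List.mem_map.1 this
        simp at hy
        subst hy
        trivial
    have hhead : w.head hwne = some u := by simp [hw]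
    have hlast : w.getLast hwne = some v := by simp [hw]
    have hmem : ∀ x, (x ∈ u :: A ∨ x ∈ v :: B) → some x ∈ w := by
      intro x hx
      simp [hw] at hx ⊢
      tauto
    have hnone : w.idxOf none = (u :: A).length := by
      rw [hw, List.idxOf_append_of_notMem (by simp)]
      simp
    have hlt : ∀ x ∈ u :: A, w.idxOf (some x) < (u :: A).length := by
      intro x hx
      have hx' : some x ∈ (u :: A).map some := List.mem_map_of_mem hx
      rw [hw, List.idxOf_append_of_mem hx']
      have := List.idxOf_lt_length_of_mem hx'
      simpa using this
    have hgt : ∀ x ∈ v :: B, (u :: A).length < w.idxOf (some x) := by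
      intro x hx
      have hx' : some x ∉ (u :: A).map some := by
        intro h
        obtain ⟨y, hy, hyx⟩ := List.mem_map.1 h
        rw [Option.some.injEq] at hyx
        subst hyx
        exact hnd'.2.2 hy hx
      rw [hw, List.idxOf_append_of_notMem hx', List.idxOf_cons_ne _ (by simp), List.length_map]
      omega
    have hcard : ∀ X : Finset V, (insert none (X.map Function.Embedding.some)).card = X.card + 1 := by
      intro X
      rw [Finset.card_insert_of_notMem (by simp), Finset.card_map]
    obtain ⟨c, hc1, hc2, hc3, hc4⟩ := cycle_lemma' w hwnd hwch hwne
      (insert none (S.map Function.Embedding.some)) (insert none (T.map Function.Embedding.some))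
      (by
        intro x hx
        rw [hhead]
        rcases Finset.mem_insert.1 hx with rfl | hx
        · exact ⟨by simp [hw], trivial⟩
        · obtain ⟨y, hy, rfl⟩ := Finset.mem_map.1 hx
          exact ⟨hmem y (hS y hy).1, (hS y hy).2⟩)
      (by
        intro x hx
        rw [hlast]
        rcases Finset.mem_insert.1 hx with rfl | hx
        · exact ⟨by simp [hw], trivial⟩
        · obtain ⟨y, hy, rfl⟩ := Finset.mem_map.1 hx
          exact ⟨hmem y (hT y hy).1, (hT y hy).2⟩)
      (by
        rcases hc with ⟨x, hx, hx'⟩ | ⟨x, hx, hx'⟩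
        · refine ⟨some x, by simp [hx], none, by simp, ?_⟩
          rw [hnone]
          exact hgt x hx'
        · refine ⟨none, by simp, some x, by simp [hx], ?_⟩
          rw [hnone]
          exact hlt x hx')
    have := cone_cycle hk c hc1 hc2 hc3
    rw [hcard, hcard] at hc4
    have hwl : w.length = (u :: A).length + (v :: B).length + 1 := by
      simp [hw]
      omega
    omega
  · push Not at hc
    obtain ⟨a, b, R, ha, hb, hRnd, hRch, hR⟩ := connect hG (u :: A) (v :: B) u v (by simp) (by simp)
      (by rintro rfl; exact hnd'.2.2 (List.mem_cons_self (a := u) (l := A)) (List.mem_cons_self (a := u) (l := B)))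
    obtain ⟨Q1, h11, h12, h13, h14⟩ := reroute u A hnd'.1 hA S
      (fun x hx => ⟨(hS x hx).1.resolve_right (hc.1 x hx), (hS x hx).2⟩) a ha
    obtain ⟨Q2, h21, h22, h23, h24⟩ := reroute v B hnd'.2.1 hB T
      (fun x hx => ⟨(hT x hx).1.resolve_left (hc.2 x hx), (hT x hx).2⟩) b hb
    have := hk (Q1.reverse ++ (a :: R ++ [b]) ++ Q2) ?_ ?_
    · simp at this
      omega
    · have e : Q1.reverse ++ (a :: R ++ [b]) ++ Q2 = (a :: Q1).reverse ++ (R ++ (b :: Q2)) := by simp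
      have hRnd' : R.Nodup := by
        refine hRnd.sublist ?_
        rw [List.cons_append]
        exact (List.sublist_append_left _ _).trans (List.sublist_cons_self _ _)
      rw [e, List.nodup_append', List.nodup_append', List.nodup_reverse]
      refine ⟨h11, ⟨hRnd', h21, fun x hx hx' => (hR x hx).2 (h23 x hx')⟩, ?_⟩
      intro x hx hx'
      rw [List.mem_reverse] at hx
      rcases List.mem_append.1 hx' with h | h
      · exact (hR x h).1 (h13 x hx)
      · exact hnd'.2.2 (h13 x hx) (h23 x h)
    · rw [List.isChain_cons] at h12 h22
      refine List.IsChain.append (List.IsChain.append (chain_rev h12.2) hRch ?_) h22.2 ?_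
      · intro x hx y hy
        rw [List.getLast?_reverse] at hx
        simp at hy
        subst hy
        exact (h12.1 x hx).symm
      · intro x hx y hy
        rw [List.getLast?_append_of_ne_nil _ (by simp), List.getLast?_append_of_ne_nil _ (by simp)] at hx
        simp at hx
        subst hx
        exact h22.1 y hy

/-- `G` is edge-maximal without a path on `k` vertices. -/
def MaxNoPath {V : Type*} (G : SimpleGraph V) (k : ℕ) : Prop :=
  NoPath G k ∧ ∀ u v, u ≠ v → ¬ G.Adj u v → ¬ NoPath (G ⊔ SimpleGraph.edge u v) k

theorem two_paths {V : Type*} [DecidableEq V] {G : SimpleGraph V} {k : ℕ} (hk : MaxNoPath G k) (u v : V)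
    (huv : u ≠ v) (hadj : ¬ G.Adj u v) :
    ∃ A B : List V, ((u :: A) ++ (v :: B)).Nodup ∧ (u :: A).IsChain G.Adj ∧
      (v :: B).IsChain G.Adj ∧ k ≤ (u :: A).length + (v :: B).length := by
  have h := hk.2 u v huv hadj
  unfold NoPath at h
  push Not at h
  obtain ⟨l, hnd, hch, hlen⟩ := h
  have hnot : ¬ l.IsChain G.Adj := fun h => absurd (hk.1 l hnd h) (by omega)
  rw [List.isChain_iff_getElem] at hnot
  push Not at hnot
  obtain ⟨i, hi, hni⟩ := hnot
  have key : ∀ (j : ℕ) (hj : j + 1 < l.length), ¬ G.Adj l[j] l[j+1] →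
      (l[j] = u ∧ l[j+1] = v) ∨ (l[j] = v ∧ l[j+1] = u) := by
    intro j hj hn
    have := (List.isChain_iff_getElem.1 hch) j hj
    rw [SimpleGraph.sup_adj, SimpleGraph.edge_adj] at this
    rcases this with h | h
    · exact absurd h hn
    · tauto
  have huniq : ∀ (j : ℕ) (hj : j + 1 < l.length), ¬ G.Adj l[j] l[j+1] → j = i := by
    intro j hj hn
    have e := hnd.getElem_inj_iff (i := j) (hi := by omega) (j := i) (hj := by omega)
    have e1 := hnd.getElem_inj_iff (i := j) (hi := by omega) (j := i+1) (hj := by omega)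
    have e2 := hnd.getElem_inj_iff (i := j+1) (hi := by omega) (j := i) (hj := by omega)
    rcases key j hj hn with ⟨h1, h2⟩ | ⟨h1, h2⟩ <;> rcases key i hi hni with ⟨h3, h4⟩ | ⟨h3, h4⟩
    · exact e.1 (by rw [h1, h3])
    · have := e1.1 (by rw [h1, h4])
      have := e2.1 (by rw [h2, h3])
      omega
    · have := e1.1 (by rw [h1, h4])
      have := e2.1 (by rw [h2, h3])
      omega
    · exact e.1 (by rw [h1, h3])
  have hc1 : (l.take (i+1)).reverse.IsChain G.Adj := by
    apply chain_rev
    rw [List.isChain_iff_getElem]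
    intro j hj
    rw [List.length_take] at hj
    by_contra hn
    rw [List.getElem_take, List.getElem_take] at hn
    have := huniq j (by omega) hn
    omega
  have hc2 : (l.drop (i+1)).IsChain G.Adj := by
    rw [List.isChain_iff_getElem]
    intro j hj
    rw [List.length_drop] at hj
    by_contra hn
    rw [List.getElem_drop, List.getElem_drop] at hn
    have := huniq (i + 1 + j) (by omega) hn
    omega
  have hl1 : (l.take (i+1)).reverse = l[i] :: (l.take i).reverse := by
    rw [List.take_succ_eq_append_getElem (by omega)]
    simp
  have hl2 : l.drop (i+1) = l[i+1] :: l.drop (i+2) := by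
    rw [List.drop_eq_getElem_cons hi]
  have hnn : ((l.take (i+1)).reverse ++ l.drop (i+1)).Nodup := by
    have : ((l.take (i+1)).reverse ++ l.drop (i+1)).Perm l := by
      have h := (List.reverse_perm (l.take (i+1))).append_right (l.drop (i+1))
      rwa [List.take_append_drop] at h
    exact this.nodup_iff.2 hnd
  rw [hl1] at hc1 hnn
  rw [hl2] at hc2 hnn
  have hL : k ≤ (l[i] :: (l.take i).reverse).length + (l[i+1] :: l.drop (i+2)).length := by
    simp
    omega
  rcases key i hi hni with ⟨h1, h2⟩ | ⟨h1, h2⟩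
  · rw [h1] at hc1 hnn hL
    rw [h2] at hc2 hnn hL
    exact ⟨_, _, hnn, hc1, hc2, hL⟩
  · rw [h1] at hc1 hnn hL
    rw [h2] at hc2 hnn hL
    exact ⟨_, _, List.perm_append_comm.nodup hnn, hc2, hc1, by omega⟩

theorem adj_of_cores {V : Type*} [Fintype V] [DecidableEq V] {G : SimpleGraph V} [DecidableRel G.Adj]
    (hG : G.Connected) {k : ℕ} (hk : MaxNoPath G k) (C1 C2 : Finset V) (d1 d2 : ℕ)
    (h1 : ∀ u ∈ C1, d1 ≤ (C1.filter (G.Adj u)).card)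
    (h2 : ∀ u ∈ C2, d2 ≤ (C2.filter (G.Adj u)).card) (hd : k ≤ d1 + d2 + 1) :
    ∀ u ∈ C1, ∀ v ∈ C2, u ≠ v → G.Adj u v := by
  by_contra hcon
  push Not at hcon
  let P : ℕ → Prop := fun m => ∃ u v A B, u ∈ C1 ∧ v ∈ C2 ∧ u ≠ v ∧ ¬ G.Adj u v ∧
    ((u :: A) ++ (v :: B)).Nodup ∧ (u :: A).IsChain G.Adj ∧
      (v :: B).IsChain G.Adj ∧ k ≤ (u :: A).length + (v :: B).length ∧
      ((u :: A) ++ (v :: B)).length = m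
  have hP : ∃ m, P m := by
    obtain ⟨u, hu, v, hv, huv, hadj⟩ := hcon
    obtain ⟨A, B, h⟩ := two_paths hk u v huv hadj
    exact ⟨_, u, v, A, B, hu, hv, huv, hadj, h.1, h.2.1, h.2.2.1, h.2.2.2, rfl⟩
  have hbd : ∀ m, P m → m ≤ Fintype.card V := by
    rintro m ⟨u, v, A, B, _, _, _, _, hnd, _, _, _, rfl⟩
    exact hnd.length_le_card
  classical
  obtain ⟨m, hm, hmax⟩ : ∃ m, P m ∧ ∀ m', P m' → m' ≤ m := by
    obtain ⟨m0, hm0⟩ := hP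
    exact ⟨Nat.findGreatest P (Fintype.card V), Nat.findGreatest_spec (hbd _ hm0) hm0,
      fun m' h => Nat.le_findGreatest (hbd _ h) h⟩
  obtain ⟨u, v, A, B, hu, hv, huv, hadj, hnd, hA, hB, hlen, rfl⟩ := hm
  have hnd' := List.nodup_append'.1 hnd
  refine lemX hG hk.1 u v A B hnd hA hB (C1.filter (G.Adj u)) (C2.filter (G.Adj v)) ?_ ?_ hlen ?_
  · intro x hx
    rw [Finset.mem_filter] at hx
    refine ⟨?_, hx.2⟩
    by_contra hxn
    push Not at hxn
    have hndx : (x :: ((u :: A) ++ (v :: B))).Nodup := by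
      rw [List.nodup_cons, List.mem_append]
      exact ⟨by tauto, hnd⟩
    by_cases hxv : G.Adj x v
    · have := hk.1 ((u :: A).reverse ++ x :: v :: B) ?_ ?_
      · simp at this hlen
        omega
      · refine List.Perm.nodup ?_ hndx
        refine (List.perm_middle.symm).trans ?_
        exact (List.reverse_perm (u :: A)).symm.append_right _
      · refine List.IsChain.append (chain_rev hA) (List.isChain_cons_cons.2 ⟨hxv, hB⟩) ?_
        intro a ha b hb
        simp at ha hb
        subst ha hb
        exact hx.2
    · have := hmax _ ⟨x, v, u :: A, B, hx.1, hv, ?_, hxv, ?_, ?_, hB, ?_, rfl⟩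
      · simp at this
      · rintro rfl
        simp at hxn
      · simpa using hndx
      · exact List.isChain_cons_cons.2 ⟨hx.2.symm, hA⟩
      · simp at hlen ⊢
        omega
  · intro x hx
    rw [Finset.mem_filter] at hx
    refine ⟨?_, hx.2⟩
    by_contra hxn
    push Not at hxn
    have hndx : (x :: ((u :: A) ++ (v :: B))).Nodup := by
      rw [List.nodup_cons, List.mem_append]
      exact ⟨by tauto, hnd⟩
    by_cases hxv : G.Adj u x
    · have := hk.1 ((u :: A).reverse ++ x :: v :: B) ?_ ?_
      · simp at this hlen
        omega
      · refine List.Perm.nodup ?_ hndx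
        refine (List.perm_middle.symm).trans ?_
        exact (List.reverse_perm (u :: A)).symm.append_right _
      · refine List.IsChain.append (chain_rev hA) (List.isChain_cons_cons.2 ⟨hx.2.symm, hB⟩) ?_
        intro a ha b hb
        simp at ha hb
        subst ha hb
        exact hxv
    · have := hmax _ ⟨u, x, A, v :: B, hu, hx.1, ?_, hxv, ?_, hA, ?_, ?_, rfl⟩
      · simp at this
      · rintro rfl
        simp at hxn
      · exact List.perm_middle.symm.nodup hndx
      · exact List.isChain_cons_cons.2 ⟨hx.2.symm, hB⟩
      · simp at hlen ⊢
        omega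
  · have := h1 u hu
    have := h2 v hv
    omega

open Classical in
/-- the `t`-core: the largest vertex set inducing minimum degree at least `t + 1` -/
noncomputable def core {V : Type*} [Fintype V] (G : SimpleGraph V) (t : ℕ) : Finset V :=
  Finset.univ.filter (fun v => ∃ C : Finset V, v ∈ C ∧ ∀ u ∈ C, t + 1 ≤ (C.filter (G.Adj u)).card)

open Classical in
theorem subset_core {V : Type*} [Fintype V] (G : SimpleGraph V) (t : ℕ) (C : Finset V)
    (hC : ∀ u ∈ C, t + 1 ≤ (C.filter (G.Adj u)).card) : C ⊆ core G t := by
  intro v hv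
  exact Finset.mem_filter.2 ⟨Finset.mem_univ _, C, hv, hC⟩

open Classical in
theorem core_deg {V : Type*} [Fintype V] (G : SimpleGraph V) (t : ℕ) (u : V) (hu : u ∈ core G t) :
    t + 1 ≤ ((core G t).filter (G.Adj u)).card := by
  obtain ⟨C, huC, hC⟩ := (Finset.mem_filter.1 hu).2
  exact (hC u huC).trans (Finset.card_le_card (Finset.filter_subset_filter _ (subset_core G t C hC)))

open Classical in
theorem exists_low {V : Type*} [Fintype V] (G : SimpleGraph V) (t : ℕ) (W : Finset V)
    (hW : core G t ⊆ W) (hne : (core G t).card < W.card) :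
    ∃ w ∈ W, w ∉ core G t ∧ (W.filter (G.Adj w)).card ≤ t := by
  by_contra hcon
  push Not at hcon
  have : W ⊆ core G t := by
    apply subset_core
    intro u hu
    by_cases h : u ∈ core G t
    · exact (core_deg G t u h).trans (Finset.card_le_card (Finset.filter_subset_filter _ hW))
    · exact hcon u hu h
  have := Finset.card_le_card this
  omega

open Classical in
/-- ordered copies of `K_{s,s}` inside `W` -/
noncomputable def prs {V : Type*} (G : SimpleGraph V) (s : ℕ) (W : Finset V) :
    Finset (Finset V × Finset V) :=
  (W.powersetCard s ×ˢ W.powersetCard s).filter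
    (fun p => Disjoint p.1 p.2 ∧ ∀ x ∈ p.1, ∀ y ∈ p.2, G.Adj x y)

open Classical in
theorem mem_prs {V : Type*} {G : SimpleGraph V} {s : ℕ} {W : Finset V} {p : Finset V × Finset V} :
    p ∈ prs G s W ↔ ((p.1 ⊆ W ∧ p.1.card = s) ∧ (p.2 ⊆ W ∧ p.2.card = s)) ∧
      Disjoint p.1 p.2 ∧ ∀ x ∈ p.1, ∀ y ∈ p.2, G.Adj x y := by
  unfold prs
  rw [Finset.mem_filter, Finset.mem_product, Finset.mem_powersetCard, Finset.mem_powersetCard]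

open Classical in
theorem prs_base {V : Type*} (G : SimpleGraph V) (s : ℕ) (W : Finset V) :
    (prs G s W).card ≤ W.card.choose (2 * s) * (2 * s).choose s := by
  have hsub : prs G s W ⊆ (W.powersetCard (2 * s)).biUnion
      (fun U => (U.powersetCard s).image (fun S => (S, U \ S))) := by
    rintro ⟨S, T⟩ hp
    obtain ⟨⟨⟨h1, h2⟩, h3, h4⟩, h5, -⟩ := mem_prs.1 hp
    simp only at h1 h2 h3 h4 h5
    rw [Finset.mem_biUnion]
    refine ⟨S ∪ T, Finset.mem_powersetCard.2 ⟨Finset.union_subset h1 h3, ?_⟩,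
      Finset.mem_image.2 ⟨S, Finset.mem_powersetCard.2 ⟨Finset.subset_union_left, h2⟩, ?_⟩⟩
    · rw [Finset.card_union_of_disjoint h5]
      omega
    · rw [Finset.union_sdiff_cancel_left h5]
  refine (Finset.card_le_card hsub).trans ?_
  refine (Finset.card_biUnion_le_card_mul _ _ ((2 * s).choose s) ?_).trans_eq ?_
  · intro U hU
    refine Finset.card_image_le.trans ?_
    rw [Finset.card_powersetCard, (Finset.mem_powersetCard.1 hU).2]
  · rw [Finset.card_powersetCard]

open Classical in
theorem prs_step {V : Type*} (G : SimpleGraph V) (s t : ℕ) (W : Finset V) (w : V)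
    (hw : w ∈ W) (hd : (W.filter (G.Adj w)).card ≤ t) :
    (prs G s W).card ≤ (prs G s (W.erase w)).card +
      2 * (t.choose s * (W.card - 1 - s).choose (s - 1)) := by
  set X := (prs G s W).filter (fun p => w ∈ p.1) with hX
  have hXc : X.card ≤ t.choose s * (W.card - 1 - s).choose (s - 1) := by
    have hsub : X ⊆ ((W.filter (G.Adj w)).powersetCard s).biUnion
        (fun T => (((W.erase w) \ T).powersetCard (s - 1)).image (fun S => (insert w S, T))) := by
      rintro ⟨S, T⟩ hp
      obtain ⟨hp, hwS⟩ := Finset.mem_filter.1 hp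
      obtain ⟨⟨⟨h1, h2⟩, h3, h4⟩, h5, h6⟩ := mem_prs.1 hp
      simp only at h1 h2 h3 h4 h5 h6 hwS
      rw [Finset.mem_biUnion]
      refine ⟨T, Finset.mem_powersetCard.2 ⟨?_, h4⟩, Finset.mem_image.2 ⟨S.erase w,
        Finset.mem_powersetCard.2 ⟨?_, ?_⟩, ?_⟩⟩
      · intro y hy
        exact Finset.mem_filter.2 ⟨h3 hy, h6 w hwS y hy⟩
      · intro y hy
        obtain ⟨hy1, hy2⟩ := Finset.mem_erase.1 hy
        exact Finset.mem_sdiff.2 ⟨Finset.mem_erase.2 ⟨hy1, h1 hy2⟩, Finset.disjoint_left.1 h5 hy2⟩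
      · rw [Finset.card_erase_of_mem hwS, h2]
      · rw [Finset.insert_erase hwS]
    refine (Finset.card_le_card hsub).trans ?_
    refine (Finset.card_biUnion_le_card_mul _ _ ((W.card - 1 - s).choose (s - 1)) ?_).trans ?_
    · intro T hT
      obtain ⟨hT1, hT2⟩ := Finset.mem_powersetCard.1 hT
      refine Finset.card_image_le.trans ?_
      rw [Finset.card_powersetCard, Finset.card_sdiff_of_subset, Finset.card_erase_of_mem hw, hT2]
      intro y hy
      obtain ⟨hy1, hy2⟩ := Finset.mem_filter.1 (hT1 hy)
      exact Finset.mem_erase.2 ⟨hy2.ne', hy1⟩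
    · rw [Finset.card_powersetCard]
      exact Nat.mul_le_mul_right _ (Nat.choose_le_choose _ hd)
  have hsub : prs G s W ⊆ prs G s (W.erase w) ∪ (X ∪ X.image Prod.swap) := by
    rintro ⟨S, T⟩ hp
    obtain ⟨⟨⟨h1, h2⟩, h3, h4⟩, h5, h6⟩ := mem_prs.1 hp
    simp only at h1 h2 h3 h4 h5 h6
    rw [Finset.mem_union, Finset.mem_union]
    by_cases hS : w ∈ S
    · exact Or.inr (Or.inl (Finset.mem_filter.2 ⟨hp, hS⟩))
    by_cases hT : w ∈ T
    · refine Or.inr (Or.inr (Finset.mem_image.2 ⟨(T, S), Finset.mem_filter.2 ⟨mem_prs.2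
        ⟨⟨⟨h3, h4⟩, h1, h2⟩, h5.symm, fun x hx y hy => (h6 y hy x hx).symm⟩, hT⟩, rfl⟩))
    · refine Or.inl (mem_prs.2 ⟨⟨⟨?_, h2⟩, ?_, h4⟩, h5, h6⟩)
      · exact Finset.subset_erase.2 ⟨h1, hS⟩
      · exact Finset.subset_erase.2 ⟨h3, hT⟩
  have e1 := Finset.card_le_card hsub
  have e2 := Finset.card_union_le (prs G s (W.erase w)) (X ∪ X.image Prod.swap)
  have e3 := Finset.card_union_le X (X.image Prod.swap)
  have e4 : (X.image Prod.swap).card ≤ X.card := Finset.card_image_le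
  omega

theorem prs_le {V : Type*} [Fintype V] (G : SimpleGraph V) (s t c : ℕ) (hs : 1 ≤ s)
    (hc : (core G t).card ≤ c) (d : ℕ) : ∀ W : Finset V, core G t ⊆ W → W.card = c + d →
    (prs G s W).card ≤ 2 * (∑ j ∈ Finset.Ico c (c + d), t.choose s * (j - s).choose (s - 1)) +
      c.choose (2 * s) * (2 * s).choose s := by
  classical
  induction d with
  | zero =>
    intro W _ hWc
    have := prs_base G s W
    rw [hWc] at this
    simpa using this
  | succ d ih =>
    intro W hW hWc
    obtain ⟨w, hw, hwc, hd⟩ := exists_low G t W hW (by omega)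
    have h1 := prs_step G s t W w hw (by convert hd)
    have h2 := ih (W.erase w) (Finset.subset_erase.2 ⟨hW, hwc⟩) (by
      rw [Finset.card_erase_of_mem hw]; omega)
    rw [← add_assoc, Finset.sum_Ico_succ_top (by omega)]
    rw [hWc] at h1
    have : c + (d + 1) - 1 = c + d := by omega
    rw [this] at h1
    omega

theorem half_choose (s : ℕ) (hs : 1 ≤ s) : (2 * s).choose s = 2 * (2 * s - 1).choose s := by
  obtain ⟨σ, rfl⟩ : ∃ σ, s = σ + 1 := ⟨s - 1, by omega⟩
  have e : 2 * (σ + 1) = (2 * σ + 1) + 1 := by ring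
  rw [e, Nat.choose_succ_succ, Nat.add_sub_cancel]
  rw [Nat.choose_symm_half σ]
  ring

theorem gss_eq (n m a s : ℕ) (hs : 1 ≤ s) (ham : a ≤ m) (hmn : m ≤ n) :
    gss n m a s = a.choose s * (∑ j ∈ Finset.Ico (m - a) n, (j - s).choose (s - 1)) +
      (m - a).choose (2 * s) * (2 * s - 1).choose s := by
  unfold gss
  congr 1
  · rw [Finset.mul_sum]
    refine Finset.sum_nbij' (fun i => n - i) (fun i => n - i) ?_ ?_ ?_ ?_ ?_
    · intro i hi
      rw [Finset.mem_Icc] at hi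
      rw [Finset.mem_Ico]
      omega
    · intro i hi
      rw [Finset.mem_Ico] at hi
      rw [Finset.mem_Icc]
      omega
    · intro i hi
      rw [Finset.mem_Icc] at hi
      omega
    · intro i hi
      rw [Finset.mem_Ico] at hi
      omega
    · intro i _
      rw [Nat.sub_right_comm]
  · rw [half_choose s hs, mul_left_comm]
    exact Nat.mul_div_cancel_left _ (by norm_num)

theorem count_le {V : Type*} [Fintype V] (G : SimpleGraph V) (n m a s : ℕ) (hs : 1 ≤ s)
    (hn : Fintype.card V = n) (ham : a ≤ m) (hmn : m ≤ n) (hc : (core G a).card ≤ m - a) :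
    (prs G s Finset.univ).card / 2 ≤ gss n m a s := by
  have h := prs_le G s a (m - a) hs hc (n - (m - a)) Finset.univ (Finset.subset_univ _) (by
    rw [Finset.card_univ]; omega)
  rw [gss_eq n m a s hs ham hmn]
  have e : m - a + (n - (m - a)) = n := by omega
  rw [e, ← Finset.mul_sum, half_choose s hs, mul_left_comm _ 2] at h
  omega

theorem kss_le {V : Type*} [Fintype V] (G G' : SimpleGraph V) (h : G ≤ G') (s : ℕ) :
    kssCount G s ≤ (prs G' s Finset.univ).card / 2 := by
  unfold kssCount
  apply Nat.div_le_div_right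
  rw [← Set.ncard_coe_finset]
  apply Set.ncard_le_ncard _ (Set.toFinite _)
  rintro p ⟨h1, h2, h3, h4⟩
  exact Finset.mem_coe.2 (mem_prs.2 ⟨⟨⟨Finset.subset_univ _, h1⟩, Finset.subset_univ _, h2⟩, h3,
    fun x hx y hy => h (h4 x hx y hy)⟩)

theorem kss_zero {V : Type*} [Fintype V] (G : SimpleGraph V) : kssCount G 0 = 0 := by
  unfold kssCount
  have : ({p : Finset V × Finset V | p.1.card = 0 ∧ p.2.card = 0 ∧ Disjoint p.1 p.2 ∧
      ∀ x ∈ p.1, ∀ y ∈ p.2, G.Adj x y} : Set (Finset V × Finset V)).ncard ≤ 1 := by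
    rw [Set.ncard_le_one (Set.toFinite _)]
    rintro ⟨a, b⟩ ⟨h1, h2, -⟩ ⟨c, d⟩ ⟨h3, h4, -⟩
    simp only [Finset.card_eq_zero] at h1 h2 h3 h4
    rw [h1, h2, h3, h4]
  omega

theorem gss_step (n m a s : ℕ) (hs : 1 ≤ s) (ham : a + 1 ≤ m) (hmn : m ≤ n) :
    gss n m (a + 1) s + (m - (a + 1)).choose s * (m - (a + 1) - s).choose (s - 1) =
    gss n m a s + a.choose (s - 1) * (∑ j ∈ Finset.Ico (m - (a + 1)) n, (j - s).choose (s - 1)) +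
      a.choose s * (m - (a + 1) - s).choose (s - 1) := by
  rw [gss_eq n m (a + 1) s hs ham hmn, gss_eq n m a s hs (by omega) hmn]
  obtain ⟨q, hq⟩ : ∃ q, m = a + 1 + q := ⟨m - (a + 1), by omega⟩
  have e1 : m - (a + 1) = q := by omega
  have e2 : m - a = q + 1 := by omega
  obtain ⟨σ, rfl⟩ : ∃ σ, s = σ + 1 := ⟨s - 1, by omega⟩
  rw [e1, e2, Finset.sum_eq_sum_Ico_succ_bot (by omega : q < n)]
  have e3 : 2 * (σ + 1) = (2 * σ + 1) + 1 := by ring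
  rw [e3]
  simp only [Nat.add_sub_cancel]
  rw [Nat.choose_succ_succ a σ, Nat.choose_succ_succ q (2 * σ + 1)]
  have key : q.choose (2 * σ + 1) * (2 * σ + 1).choose (σ + 1) =
      q.choose (σ + 1) * (q - (σ + 1)).choose σ := by
    rw [Nat.choose_mul (by omega)]
    congr 2
    omega
  simp only [Nat.succ_eq_add_one]
  nlinarith [key]

theorem gss_diff_mono (n m a b s : ℕ) (hs : 1 ≤ s) (hab : a ≤ b) (hbm : 2 * b + 1 ≤ m) (hmn : m ≤ n) :
    (gss n m (a + 1) s : ℤ) - gss n m a s ≤ gss n m (b + 1) s - gss n m b s := by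
  have ha := gss_step n m a s hs (by omega) hmn
  have hb := gss_step n m b s hs (by omega) hmn
  have h1 : a.choose (s - 1) * (∑ j ∈ Finset.Ico (m - (a + 1)) n, (j - s).choose (s - 1)) ≤
      b.choose (s - 1) * (∑ j ∈ Finset.Ico (m - (b + 1)) n, (j - s).choose (s - 1)) := by
    apply Nat.mul_le_mul (Nat.choose_le_choose _ hab)
    apply Finset.sum_le_sum_of_subset
    apply Finset.Ico_subset_Ico_left
    omega
  have h2 : a.choose s ≤ b.choose s := Nat.choose_le_choose _ hab
  have h3 : b.choose s ≤ (m - (b + 1)).choose s := Nat.choose_le_choose _ (by omega)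
  have h4 : (m - (b + 1)).choose s ≤ (m - (a + 1)).choose s := Nat.choose_le_choose _ (by omega)
  have h5 : (m - (b + 1) - s).choose (s - 1) ≤ (m - (a + 1) - s).choose (s - 1) :=
    Nat.choose_le_choose _ (by omega)
  generalize a.choose (s - 1) * (∑ j ∈ Finset.Ico (m - (a + 1)) n, (j - s).choose (s - 1)) = ua at *
  generalize b.choose (s - 1) * (∑ j ∈ Finset.Ico (m - (b + 1)) n, (j - s).choose (s - 1)) = ub at *
  generalize a.choose s = pa at *
  generalize b.choose s = pb at *
  generalize (m - (b + 1)).choose s = qb at *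
  generalize (m - (a + 1)).choose s = qa at *
  generalize (m - (b + 1) - s).choose (s - 1) = yb at *
  generalize (m - (a + 1) - s).choose (s - 1) = ya at *
  generalize gss n m (a + 1) s = ga' at *
  generalize gss n m (b + 1) s = gb' at *
  generalize gss n m a s = ga at *
  generalize gss n m b s = gb at *
  zify at *
  have h6 : ((qb : ℤ) - pb) * yb ≤ ((qa : ℤ) - pa) * ya := by
    apply mul_le_mul
    · linarith
    · exact h5
    · exact Int.natCast_nonneg _
    · linarith
  linarith

theorem gss_le_max (n m r a h s : ℕ) (hs : 1 ≤ s) (hra : r ≤ a) (hah : a ≤ h) (hm : 2 * h + 1 ≤ m)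
    (hmn : m ≤ n) : gss n m a s ≤ max (gss n m r s) (gss n m h s) := by
  by_cases hΔ : gss n m a s ≤ gss n m (a + 1) s
  · apply le_max_of_le_right
    have : ∀ d, a + d ≤ h → gss n m a s ≤ gss n m (a + d) s := by
      intro d
      induction d with
      | zero => intro _; exact le_rfl
      | succ d ih =>
        intro hd
        have h1 := ih (by omega)
        have h2 := gss_diff_mono n m a (a + d) s hs (by omega) (by omega) hmn
        rw [← add_assoc]
        omega
    have h2 := this (h - a) (by omega)
    rwa [Nat.add_sub_cancel' hah] at h2
  · apply le_max_of_le_left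
    have : ∀ d, r + d ≤ a → gss n m (r + d) s ≤ gss n m r s := by
      intro d
      induction d with
      | zero => intro _; exact le_rfl
      | succ d ih =>
        intro hd
        have h1 := ih (by omega)
        have h2 := gss_diff_mono n m (r + d) a s hs (by omega) (by omega) hmn
        rw [← add_assoc]
        omega
    have h2 := this (a - r) (by omega)
    rwa [Nat.add_sub_cancel' hra] at h2

theorem final_aux {V : Type*} [Fintype V] [DecidableEq V] (G : SimpleGraph V) (n k r s : ℕ)
    (hcard : Fintype.card V = n) (hconn : G.Connected) (hs : 1 ≤ s)
    (hδ : ∀ v : V, ∃ C : Finset V, r ≤ C.card ∧ ∀ x ∈ C, G.Adj v x)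
    (hk : 4 ≤ k) (hkn : k ≤ n) (hmax : MaxNoPath G k) :
    (prs G s Finset.univ).card / 2 ≤ max (gss n (k - 1) r s) (gss n (k - 1) ((k - 2) / 2) s) := by
  classical
  obtain ⟨h, hh⟩ : ∃ h, h = (k - 2) / 2 := ⟨_, rfl⟩
  obtain ⟨m, hm⟩ : ∃ m, m = k - 1 := ⟨_, rfl⟩
  rw [← hh, ← hm]
  have hclique := adj_of_cores hconn hmax (core G h) (core G h) (h + 1) (h + 1)
    (core_deg G h) (core_deg G h) (by omega)
  by_cases hsmall : (core G h).card ≤ m - h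
  · exact (count_le G n m h s hs hcard (by omega) (by omega) hsmall).trans (le_max_right _ _)
  have hlk : (core G h).card < k := by
    have := hmax.1 (core G h).toList (Finset.nodup_toList _) (by
      apply List.Pairwise.isChain
      refine (Finset.nodup_toList (core G h)).imp_of_mem ?_
      intro a b ha hb hab
      exact hclique a (Finset.mem_toList.1 ha) b (Finset.mem_toList.1 hb) hab)
    simpa using this
  obtain ⟨a, ha⟩ : ∃ a, a = m - (core G h).card := ⟨_, rfl⟩
  have hadj := adj_of_cores hconn hmax (core G h) (core G a) ((core G h).card - 1) (a + 1)
    (by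
      intro u hu
      rw [← Finset.card_erase_of_mem hu]
      apply Finset.card_le_card
      intro x hx
      obtain ⟨hx1, hx2⟩ := Finset.mem_erase.1 hx
      exact Finset.mem_filter.2 ⟨hx2, hclique u hu x hx2 hx1.symm⟩)
    (core_deg G a) (by omega)
  have hsub : core G a ⊆ core G h := by
    intro v hv
    by_contra hvn
    have hins : insert v (core G h) ⊆ core G h := by
      apply subset_core
      intro u hu
      rcases Finset.mem_insert.1 hu with rfl | hu
      · have : core G h ⊆ (insert u (core G h)).filter (G.Adj u) := by
          intro x hx
          refine Finset.mem_filter.2 ⟨Finset.mem_insert_of_mem hx, ?_⟩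
          exact (hadj x hx u hv (fun e => hvn (e ▸ hx))).symm
        have := Finset.card_le_card this
        omega
      · exact (core_deg G h u hu).trans (Finset.card_le_card
          (Finset.filter_subset_filter _ (Finset.subset_insert _ _)))
    exact hvn (hins (Finset.mem_insert_self _ _))
  have hca := Finset.card_le_card hsub
  have hra : r ≤ a := by
    by_contra hlt
    have huniv : Finset.univ ⊆ core G a := by
      apply subset_core
      intro u _
      obtain ⟨C, hC, hC'⟩ := hδ u
      have : C ⊆ Finset.univ.filter (G.Adj u) := fun x hx =>
        Finset.mem_filter.2 ⟨Finset.mem_univ _, hC' x hx⟩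
      have := Finset.card_le_card this
      omega
    have := Finset.card_le_card huniv
    rw [Finset.card_univ] at this
    omega
  exact (count_le G n m a s hs hcard (by omega) (by omega) (by omega)).trans
    (gss_le_max n m r a h s hs hra (by omega) (by omega) (by omega))

end KSS

/-- Let `G` be a connected graph on `n` vertices with minimum degree `≥ r ≥ 1`, where
`n ≥ k ≥ 4`; set `h = ⌊(k-2)/2⌋`. If the number of copies of `K_{s,s}` in `G` exceeds
`max {g_{s,s}(n,k-1,r), g_{s,s}(n,k-1,h)}`, then `G` contains a path on `k` vertices. -/
theorem stmt_17 {V : Type*} [Fintype V] [DecidableEq V]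
    (G : SimpleGraph V) [DecidableRel G.Adj] (n k r s : ℕ)
    (hcard : Fintype.card V = n)
    (hconn : G.Connected)
    (hr : 1 ≤ r) (hδ : ∀ v : V, r ≤ G.degree v)
    (hk : 4 ≤ k) (hkn : k ≤ n)
    (hcount : max (gss n (k - 1) r s) (gss n (k - 1) ((k - 2) / 2) s) < kssCount G s) :
    ∃ (u v : V) (p : G.Walk u v), p.IsPath ∧ p.support.length = k := by
  classical
  by_contra hno
  have hNP : KSS.NoPath G k := by
    intro l hnd hch
    by_contra hlen
    apply hno
    have hne : l.take k ≠ [] := by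
      intro h
      have := congrArg List.length h
      rw [List.length_take, List.length_nil] at this
      omega
    refine ⟨_, _, SimpleGraph.Walk.ofSupport (l.take k) hne (hch.take k), ?_, ?_⟩
    · rw [SimpleGraph.Walk.isPath_def, SimpleGraph.Walk.support_ofSupport]
      exact hnd.sublist (List.take_sublist _ _)
    · rw [SimpleGraph.Walk.support_ofSupport, List.length_take]
      omega
  rcases Nat.eq_zero_or_pos s with rfl | hs
  · rw [KSS.kss_zero] at hcount
    omega
  obtain ⟨H, hGH, hH⟩ := Finite.exists_le_maximal (p := fun H : SimpleGraph V => KSS.NoPath H k) hNP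
  have hmax : KSS.MaxNoPath H k := by
    refine ⟨hH.prop, fun u v huv hadj hcon => hadj ?_⟩
    have hle := hH.le_of_ge hcon le_sup_left
    apply hle
    rw [SimpleGraph.sup_adj, SimpleGraph.edge_adj]
    exact Or.inr ⟨Or.inl ⟨rfl, rfl⟩, huv⟩
  have h1 := KSS.final_aux H n k r s hcard (hconn.mono hGH) hs
    (fun v => ⟨G.neighborFinset v, by rw [SimpleGraph.card_neighborFinset_eq_degree]; exact hδ v,
      fun x hx => hGH ((G.mem_neighborFinset v x).1 hx)⟩) hk hkn hmax
  have h2 := KSS.kss_le G H hGH s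
  omega
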